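/- Let G be a finite group with |G| ≥ 3. If max Δ*(G) = D(G) − 2, then G is cyclic, or there is a subgroup G_1 of G such that D(G_1) = D(G) and G_1 is generated by elements of order two. -/

import Mathlib

namespace ProductOne

open scoped Classical

variable {G : Type*} [Group G]

/-- `S` is a product-one sequence over `G`: its terms can be ordered with product `1`. -/
def IsProductOne (S : Multiset G) : Prop :=
  ∃ l : List G, (l : Multiset G) = S ∧ l.prod = 1

/-- `S` is an atom (a minimal product-one sequence): it is a nontrivial product-one
sequence that is not the concatenation of two nontrivial product-one sequences. -/
def IsAtomSeq (S : Multiset G) : Prop :=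
  S ≠ 0 ∧ IsProductOne S ∧
    ∀ A B : Multiset G, S = A + B → IsProductOne A → IsProductOne B → A = 0 ∨ B = 0

/-- `S` is a sequence over the subset `G₀ ⊆ G`. -/
def SeqOn (G₀ : Set G) (S : Multiset G) : Prop := ∀ g ∈ S, g ∈ G₀

/-- `S` is an atom of the monoid `B(G₀)` of product-one sequences over `G₀`. -/
def IsAtomSeqOn (G₀ : Set G) (S : Multiset G) : Prop := SeqOn G₀ S ∧ IsAtomSeq S

/-- The set of lengths `L(A)` of factorizations of `A` into atoms over `G₀`. -/
def lengthsOn (G₀ : Set G) (A : Multiset G) : Set ℕ :=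
  {k | ∃ f : Multiset (Multiset G), Multiset.card f = k ∧
        (∀ U ∈ f, IsAtomSeqOn G₀ U) ∧ f.sum = A}

/-- The set of lengths `L(A)` over the whole group. -/
def lengths (A : Multiset G) : Set ℕ := lengthsOn Set.univ A

/-- The set of distances of a set `L ⊆ ℕ`. -/
def distancesOf (L : Set ℕ) : Set ℕ :=
  {d | 0 < d ∧ ∃ a, a ∈ L ∧ a + d ∈ L ∧ ∀ b ∈ L, ¬(a < b ∧ b < a + d)}

/-- The set of distances `Δ(G₀)` of the monoid `B(G₀)`. -/
def DeltaOn (G₀ : Set G) : Set ℕ :=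
  {d | ∃ A : Multiset G, SeqOn G₀ A ∧ IsProductOne A ∧ d ∈ distancesOf (lengthsOn G₀ A)}

/-- The set of distances `Δ(G)` of `B(G)`. -/
def Delta (G : Type*) [Group G] : Set ℕ := DeltaOn (Set.univ : Set G)

/-- The large Davenport constant of `G₀`: maximal length of an atom of `B(G₀)`. -/
noncomputable def DavenportOn (G₀ : Set G) : ℕ :=
  sSup {k | ∃ S : Multiset G, IsAtomSeqOn G₀ S ∧ Multiset.card S = k}

/-- The large Davenport constant `D(G)`. -/
noncomputable def Davenport (G : Type*) [Group G] : ℕ :=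
  DavenportOn (Set.univ : Set G)

/-- The small Davenport constant `d(G₀)`: maximal length of a product-one free
sequence over `G₀`. -/
noncomputable def smallDavenportOn (G₀ : Set G) : ℕ :=
  sSup {k | ∃ S : Multiset G, SeqOn G₀ S ∧ Multiset.card S = k ∧
        ∀ T : Multiset G, T ≤ S → T ≠ 0 → ¬IsProductOne T}

/-- `Δ*(G) = {min Δ(G₀) : G₀ ⊆ G with Δ(G₀) ≠ ∅}`. -/
def DeltaStar (G : Type*) [Group G] : Set ℕ :=
  {d | ∃ G₀ : Set G, (DeltaOn G₀).Nonempty ∧ d = sInf (DeltaOn G₀)}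

/-- The elasticity `ρ(L) = max L / min L` of a set of lengths (with the set of
positive elements used, and `ρ = 1` if there are none). -/
noncomputable def elasticity (L : Set ℕ) : ℚ :=
  if (L ∩ {k | 0 < k}).Nonempty then
    ((sSup (L ∩ {k | 0 < k}) : ℕ) : ℚ) / ((sInf (L ∩ {k | 0 < k}) : ℕ) : ℚ)
  else 1

/-- The elasticity `ρ(G₀)` of the monoid `B(G₀)`. -/
noncomputable def rhoOn (G₀ : Set G) : ℝ :=
  sSup {x : ℝ | ∃ A : Multiset G, SeqOn G₀ A ∧ IsProductOne A ∧
    x = (elasticity (lengthsOn G₀ A) : ℝ)}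

/-- `Δ*_ρ(G) = {min Δ(G₀) : G₀ ⊆ G with ρ(G₀) = D(G)/2}`. -/
noncomputable def DeltaRhoStar (G : Type*) [Group G] : Set ℕ :=
  {d | ∃ G₀ : Set G, rhoOn G₀ = (Davenport G : ℝ) / 2 ∧ d = sInf (DeltaOn G₀)}

/-- Divisibility in the monoid `B(G)`. -/
def BDvd (A S : Multiset G) : Prop :=
  ∃ C : Multiset G, IsProductOne C ∧ S = A + C

/-- The `ω`-invariant `ω(B(G), A)`. -/
noncomputable def omegaAt (A : Multiset G) : ℕ∞ :=
  sInf {N : ℕ∞ | ∀ f : Multiset (Multiset G),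
    (∀ B ∈ f, IsProductOne B) → BDvd A f.sum →
    ∃ t ≤ f, (Multiset.card t : ℕ∞) ≤ N ∧ BDvd A t.sum}

/-- `ω(G) = sup {ω(B(G), U) : U an atom of B(G)}`. -/
noncomputable def omegaInv (G : Type*) [Group G] : ℕ∞ :=
  ⨆ U ∈ {U : Multiset G | IsAtomSeq U}, omegaAt U

/-- `z` is a factorization of `A` into atoms. -/
def IsFactorization (A : Multiset G) (z : Multiset (Multiset G)) : Prop :=
  (∀ U ∈ z, IsAtomSeq U) ∧ z.sum = A

/-- The distance between two factorizations. -/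
noncomputable def factDist (z z' : Multiset (Multiset G)) : ℕ :=
  letI := Classical.decEq (Multiset G)
  max (Multiset.card (z - z')) (Multiset.card (z' - z))

/-- The catenary degree `c(A)`. -/
noncomputable def catenaryAt (A : Multiset G) : ℕ∞ :=
  sInf {N : ℕ∞ | ∀ z z' : Multiset (Multiset G),
    IsFactorization A z → IsFactorization A z' →
    Relation.ReflTransGen
      (fun x y => IsFactorization A y ∧ (factDist x y : ℕ∞) ≤ N) z z'}

/-- The set of positive catenary degrees `Ca(G)`. -/
noncomputable def CatenarySet (G : Type*) [Group G] : Set ℕ∞ :=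
  {c | ∃ A : Multiset G, IsProductOne A ∧ catenaryAt A = c ∧ 0 < c}

/-- The catenary degree `c(G)` of `B(G)`. -/
noncomputable def catenaryDegree (G : Type*) [Group G] : ℕ∞ :=
  ⨆ A ∈ {A : Multiset G | IsProductOne A}, catenaryAt A

/-- The cross number `k(S)` of a sequence. -/
noncomputable def crossNumber (S : Multiset G) : ℚ :=
  (S.map fun g => (1 : ℚ) / (orderOf g : ℚ)).sum

/-- The system of sets of lengths `L(G)`. -/
def LSystem (G : Type*) [Group G] : Set (Set ℕ) :=
  {L | ∃ A : Multiset G, IsProductOne A ∧ L = lengths A}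

/-- The set of products `π(S)` of all orderings of the terms of `S`. -/
def piSet (S : Multiset G) : Set G :=
  {g | ∃ l : List G, (l : Multiset G) = S ∧ l.prod = g}

/-- The sumset `{x₁, -x₁} + ⋯ + {x_s, -x_s}` for a sequence `a = x₁ ⋯ x_s`. -/
def signedSums {α : Type*} [AddCommGroup α] (a : Multiset α) : Set α :=
  {z | ∃ t ≤ a, z = t.sum + t.sum - a.sum}

/-- `Σ_k(T)`: the set of sums of `k`-term subsequences of `T`. -/
def subseqSums {α : Type*} [AddCommMonoid α] (k : ℕ) (T : Multiset α) : Set α :=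
  {z | ∃ t ≤ T, Multiset.card t = k ∧ t.sum = z}

/-- The subsequence `S_X` of all terms of `S` lying in `X`. -/
noncomputable def restrictTo (X : Set G) (S : Multiset G) : Multiset G :=
  letI := Classical.decPred fun g => g ∈ X
  S.filter fun g => g ∈ X

/-- The maximum multiplicity `h(S)` of a term of `S`. -/
noncomputable def maxMultiplicity {α : Type*} (S : Multiset α) : ℕ :=
  letI := Classical.decEq α
  S.toFinset.sup S.count

end ProductOne

namespace ProductOne

open scoped Classical

variable {G : Type*} [Group G]

theorem IsProductOne.exists_list_of_mem {U : Multiset G} (hU : IsProductOne U) {h : G}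
    (hh : h ∈ U) : ∃ t : List G, U = h ::ₘ (t : Multiset G) ∧ t.prod = h⁻¹ := by
  obtain ⟨l, rfl, hl⟩ := hU
  obtain ⟨a, b, rfl⟩ := List.append_of_mem (Multiset.mem_coe.1 hh)
  refine ⟨b ++ a, ?_, ?_⟩
  · rw [Multiset.cons_coe, Multiset.coe_eq_coe]
    exact List.perm_middle.trans (List.Perm.cons _ List.perm_append_comm)
  · rw [List.prod_append, List.prod_cons] at hl
    rw [List.prod_append]
    have := mul_eq_one_comm.1 hl
    rw [mul_assoc] at this
    exact eq_inv_of_mul_eq_one_right this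

theorem IsProductOne.zero : IsProductOne (0 : Multiset G) := ⟨[], rfl, rfl⟩

theorem IsProductOne.add {A B : Multiset G} (hA : IsProductOne A) (hB : IsProductOne B) :
    IsProductOne (A + B) := by
  obtain ⟨a, rfl, ha⟩ := hA
  obtain ⟨b, rfl, hb⟩ := hB
  exact ⟨a ++ b, by simp, by simp [ha, hb]⟩

theorem isProductOne_sum {f : Multiset (Multiset G)} (hf : ∀ U ∈ f, IsProductOne U) :
    IsProductOne f.sum := by
  induction f using Multiset.induction with
  | empty => exact IsProductOne.zero
  | cons U f ih =>
    rw [Multiset.sum_cons]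
    exact (hf U (by simp)).add (ih fun W hW => hf W (by simp [hW]))

theorem isProductOne_singleton {g : G} : IsProductOne ({g} : Multiset G) ↔ g = 1 := by
  constructor
  · intro h
    obtain ⟨t, ht, hp⟩ := h.exists_list_of_mem (Multiset.mem_singleton_self g)
    have : (t : Multiset G) = 0 := by
      have := congrArg Multiset.card ht
      simpa using this
    rw [Multiset.coe_eq_zero] at this
    subst this
    simpa using hp.symm
  · rintro rfl
    exact ⟨[1], rfl, by simp⟩

theorem isProductOne_replicate {g : G} {n : ℕ} :
    IsProductOne (Multiset.replicate n g) ↔ orderOf g ∣ n := by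
  rw [orderOf_dvd_iff_pow_eq_one]
  constructor
  · rintro ⟨l, hl, hp⟩
    rw [← Multiset.coe_replicate, Multiset.coe_eq_coe, List.perm_replicate] at hl
    rwa [hl, List.prod_replicate] at hp
  · intro h
    exact ⟨List.replicate n g, rfl, by rw [List.prod_replicate, h]⟩

theorem IsProductOne.mem_subgroup {K : Subgroup G} {h : G} {A : Multiset G}
    (hA : IsProductOne (h ::ₘ A)) (hK : ∀ x ∈ A, x ∈ K) : h ∈ K := by
  obtain ⟨t, ht, hp⟩ := hA.exists_list_of_mem (Multiset.mem_cons_self h A)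
  rw [Multiset.cons_inj_right] at ht
  subst ht
  have := K.list_prod_mem (l := t) fun x hx => hK x (Multiset.mem_coe.2 hx)
  rw [hp] at this
  exact K.inv_mem_iff.1 this

theorem IsAtomSeq.eq_zero_of_eq_add {S A : Multiset G} (hS : IsAtomSeq S) (hA : A ≠ 0)
    (hA1 : IsProductOne A) {B : Multiset G} (hB : IsProductOne B) (h : S = A + B) : B = 0 :=
  (hS.2.2 A B h hA1 hB).resolve_left hA

theorem IsAtomSeq.eq_singleton_one {S : Multiset G} (hS : IsAtomSeq S) (h1 : (1 : G) ∈ S) :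
    S = {1} := by
  obtain ⟨t, rfl, hp⟩ := hS.2.1.exists_list_of_mem h1
  have : (t : Multiset G) = 0 :=
    hS.eq_zero_of_eq_add (A := {1}) (by simp) (isProductOne_singleton.2 rfl)
      ⟨t, rfl, by simpa using hp⟩ (by simp)
  rw [this]
  rfl

theorem isAtomSeq_replicate_orderOf [Finite G] (g : G) :
    IsAtomSeq (Multiset.replicate (orderOf g) g) := by
  have hpos := orderOf_pos g
  refine ⟨?_, isProductOne_replicate.2 dvd_rfl, ?_⟩
  · intro h
    have := congrArg Multiset.card h
    rw [Multiset.card_replicate, Multiset.card_zero] at this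
    omega
  · intro A B h hA hB
    have hA' : A = Multiset.replicate A.card g := Multiset.eq_replicate_card.2 fun b hb =>
      Multiset.eq_of_mem_replicate (h ▸ Multiset.mem_add.2 (Or.inl hb))
    have hc := congrArg Multiset.card h
    rw [Multiset.card_replicate, Multiset.card_add] at hc
    rw [hA', isProductOne_replicate] at hA
    rcases Nat.eq_zero_or_pos A.card with h0 | h0
    · exact Or.inl (Multiset.card_eq_zero.1 h0)
    · have := Nat.le_of_dvd h0 hA
      exact Or.inr (Multiset.card_eq_zero.1 (by omega))

theorem isAtomSeq_pair_inv {g : G} (hg : g ≠ 1) : IsAtomSeq ({g, g⁻¹} : Multiset G) := by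
  refine ⟨by simp, ⟨[g, g⁻¹], rfl, by simp⟩, ?_⟩
  intro A B h hA hB
  have hc := congrArg Multiset.card h
  rw [Multiset.card_add, Multiset.card_pair] at hc
  rcases Nat.eq_zero_or_pos A.card with h0 | h0
  · exact Or.inl (Multiset.card_eq_zero.1 h0)
  rcases Nat.eq_zero_or_pos B.card with h1 | h1
  · exact Or.inr (Multiset.card_eq_zero.1 h1)
  obtain ⟨a, rfl⟩ := Multiset.card_eq_one.1 (show A.card = 1 by omega)
  have ha : a ∈ ({g, g⁻¹} : Multiset G) := h ▸ by simp
  rw [isProductOne_singleton.1 hA] at ha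
  simp at ha
  exact absurd (ha.elim Eq.symm id) hg

theorem isAtomSeq_of_notMem_zpowers [Finite G] {g h : G} (hh : h ∉ Subgroup.zpowers g) :
    IsAtomSeq (h ::ₘ (h⁻¹ * g) ::ₘ Multiset.replicate (orderOf g - 1) g) := by
  have hpos := orderOf_pos g
  refine ⟨by simp, ⟨h :: (h⁻¹ * g) :: List.replicate (orderOf g - 1) g, rfl, ?_⟩, ?_⟩
  · rw [List.prod_cons, List.prod_cons, List.prod_replicate, mul_assoc, ← pow_succ',
      mul_inv_cancel_left, Nat.sub_add_cancel hpos, pow_orderOf_eq_one]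
  · have key : ∀ A B : Multiset G,
        h ::ₘ (h⁻¹ * g) ::ₘ Multiset.replicate (orderOf g - 1) g = A + B →
        IsProductOne A → IsProductOne B → h ∈ A → B = 0 := by
      intro A B hAB hA hB hhA
      obtain ⟨A, rfl⟩ := Multiset.exists_cons_of_mem hhA
      rw [Multiset.cons_add, Multiset.cons_inj_right] at hAB
      rcases Multiset.mem_add.1 (hAB ▸ Multiset.mem_cons_self _ _) with hk | hk
      · obtain ⟨A, rfl⟩ := Multiset.exists_cons_of_mem hk
        rw [Multiset.cons_add, Multiset.cons_inj_right] at hAB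
        have hB' : B = Multiset.replicate B.card g := Multiset.eq_replicate_card.2 fun b hb =>
          Multiset.eq_of_mem_replicate (hAB ▸ Multiset.mem_add.2 (Or.inr hb))
        have hc := congrArg Multiset.card hAB
        rw [Multiset.card_replicate, Multiset.card_add] at hc
        rw [hB', isProductOne_replicate] at hB
        by_contra h0
        have := Nat.le_of_dvd (Multiset.card_pos.2 h0) hB
        omega
      · obtain ⟨B, rfl⟩ := Multiset.exists_cons_of_mem hk
        rw [Multiset.add_cons, Multiset.cons_inj_right] at hAB
        refine absurd (hA.mem_subgroup fun x hx => ?_) hh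
        have hmem : x ∈ Multiset.replicate (orderOf g - 1) g :=
          hAB ▸ Multiset.mem_add.2 (Or.inl hx)
        rw [Multiset.eq_of_mem_replicate hmem]
        exact Subgroup.mem_zpowers g
    intro A B hAB hA hB
    have hmem : h ∈ A + B := hAB ▸ Multiset.mem_cons_self _ _
    rcases Multiset.mem_add.1 hmem with hk | hk
    · exact Or.inr (key A B hAB hA hB hk)
    · exact Or.inl (key B A (hAB.trans (add_comm _ _)) hB hA hk)

theorem IsAtomSeq.card_le_natCard [Finite G] {S : Multiset G} (hS : IsAtomSeq S) :
    S.card ≤ Nat.card G := by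
  have := Fintype.ofFinite G
  obtain ⟨l, rfl, hl⟩ := hS.2.1
  by_contra! hlt
  rw [Multiset.coe_card, Nat.card_eq_fintype_card, ← Fintype.card_fin l.length] at hlt
  obtain ⟨i, j, hij, he⟩ :=
    Fintype.exists_ne_map_eq_of_card_lt (fun i : Fin l.length => (l.take i).prod)
      (by simpa using hlt)
  have key : ∀ i j : Fin l.length, (l.take i).prod = (l.take j).prod → i < j → False := by
    intro i j he hij
    have hsplit : l.take j = l.take i ++ (l.take j).drop i := by
      conv_lhs => rw [← List.take_append_drop i (l.take j)]
      rw [List.take_take, min_eq_left (by exact_mod_cast hij.le)]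
    have hmid : ((l.take j).drop i).prod = 1 := by
      rw [hsplit, List.prod_append] at he
      exact left_eq_mul.1 he
    have hl' : l = l.take i ++ ((l.take j).drop i ++ l.drop j) := by
      rw [← List.append_assoc, ← hsplit, List.take_append_drop]
    have hB : IsProductOne ((l.take i ++ l.drop j : List G) : Multiset G) := by
      refine ⟨_, rfl, ?_⟩
      rw [hl', List.prod_append, List.prod_append, hmid, one_mul] at hl
      rw [List.prod_append, hl]
    have hne : (((l.take j).drop i : List G) : Multiset G) ≠ 0 := by
      intro h0
      have := congrArg Multiset.card h0
      simp at this
      omega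
    have h0 := hS.eq_zero_of_eq_add hne ⟨_, rfl, hmid⟩ hB (by
      conv_lhs => rw [hl']
      rw [← Multiset.coe_add, ← Multiset.coe_add, ← Multiset.coe_add]
      abel)
    have := congrArg Multiset.card h0
    simp at this
    omega
  rcases lt_or_gt_of_ne hij with h | h
  · exact key i j he h
  · exact key j i he.symm h

theorem IsAtomSeqOn.card_le_davenportOn [Finite G] {G₀ : Set G} {S : Multiset G}
    (hS : IsAtomSeqOn G₀ S) : S.card ≤ DavenportOn G₀ :=
  le_csSup ⟨Nat.card G, by rintro _ ⟨T, hT, rfl⟩; exact hT.2.card_le_natCard⟩ ⟨S, hS, rfl⟩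

theorem IsAtomSeq.card_le_davenport [Finite G] {S : Multiset G} (hS : IsAtomSeq S) :
    S.card ≤ Davenport G :=
  IsAtomSeqOn.card_le_davenportOn ⟨fun _ _ => Set.mem_univ _, hS⟩

theorem orderOf_lt_davenport [Finite G] (hG : ¬IsCyclic G) (g : G) : orderOf g < Davenport G := by
  obtain ⟨h, hh⟩ : ∃ h, h ∉ Subgroup.zpowers g := by
    by_contra! hall
    exact hG ⟨g, hall⟩
  have := (isAtomSeq_of_notMem_zpowers hh).card_le_davenport
  simp only [Multiset.card_cons, Multiset.card_replicate] at this
  have := orderOf_pos g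
  omega

theorem seqOn_add {α : Type*} {G₀ : Set α} {A B : Multiset α} :
    SeqOn G₀ (A + B) ↔ SeqOn G₀ A ∧ SeqOn G₀ B := by
  simp only [SeqOn, Multiset.mem_add, or_imp, forall_and]

theorem seqOn_sum {α : Type*} {G₀ : Set α} {f : Multiset (Multiset α)} (hf : ∀ U ∈ f, SeqOn G₀ U) :
    SeqOn G₀ f.sum := by
  intro g hg
  obtain ⟨U, hU, hgU⟩ := Multiset.mem_join.1 hg
  exact hf U hU g hgU

theorem exists_factorization {G₀ : Set G} (A : Multiset G) (hA : IsProductOne A)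
    (hA₀ : SeqOn G₀ A) :
    ∃ f : Multiset (Multiset G), (∀ U ∈ f, IsAtomSeqOn G₀ U) ∧ f.sum = A := by
  induction hn : A.card using Nat.strong_induction_on generalizing A with
  | _ n ih =>
    subst hn
    by_cases h0 : A = 0
    · exact ⟨0, by simp, by simp [h0]⟩
    by_cases hat : IsAtomSeq A
    · exact ⟨{A}, by simpa using ⟨hA₀, hat⟩, by simp⟩
    simp only [IsAtomSeq, not_and, not_forall, not_or] at hat
    obtain ⟨B, C, rfl, hB, hC, hB0, hC0⟩ := hat h0 hA
    have hb := Multiset.card_pos.2 hB0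
    have hc := Multiset.card_pos.2 hC0
    rw [seqOn_add] at hA₀
    obtain ⟨f, hf, rfl⟩ := ih B.card (by rw [Multiset.card_add]; omega) B hB hA₀.1 rfl
    obtain ⟨f', hf', rfl⟩ := ih C.card (by rw [Multiset.card_add]; omega) C hC hA₀.2 rfl
    refine ⟨f + f', fun U hU => ?_, by simp⟩
    rcases Multiset.mem_add.1 hU with h | h
    exacts [hf U h, hf' U h]

/-- If the terms of a product-one sequence `V` lie in distinct members of a family `u` of
product-one sequences, then removing `V` from the concatenation of `u` leaves a product-one
sequence. -/
theorem exists_isProductOne_compl {V : Multiset G} {u : Multiset (Multiset G)}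
    (hV : IsProductOne V) (hu : ∀ U ∈ u, IsProductOne U)
    (hVu : Multiset.Rel (fun h U => h ∈ U) V u) :
    ∃ C : Multiset G, IsProductOne C ∧ u.sum = V + C := by
  obtain ⟨l, rfl, hl⟩ := hV
  suffices H : ∃ c : List G, c.prod = l.prod⁻¹ ∧ u.sum = (l : Multiset G) + (c : Multiset G) by
    obtain ⟨c, hc, hs⟩ := H
    exact ⟨c, ⟨c, rfl, by rw [hc, hl, inv_one]⟩, hs⟩
  clear hl
  induction l generalizing u with
  | nil =>
    rw [Multiset.coe_nil, Multiset.rel_zero_left] at hVu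
    exact ⟨[], by simp, by simp [hVu]⟩
  | cons h l ih =>
    rw [← Multiset.cons_coe, Multiset.rel_cons_left] at hVu
    obtain ⟨U, u, hU, hlu, rfl⟩ := hVu
    obtain ⟨c, hc, hs⟩ := ih (fun W hW => hu W (by simp [hW])) hlu
    obtain ⟨t, rfl, ht⟩ := (hu U (by simp)).exists_list_of_mem hU
    refine ⟨c ++ t, by rw [List.prod_append, hc, ht, List.prod_cons, mul_inv_rev], ?_⟩
    rw [Multiset.sum_cons, hs, ← Multiset.coe_add, ← Multiset.cons_coe, Multiset.cons_add,
      Multiset.cons_add]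
    congr 1
    abel

/-- Terms of sufficiently high multiplicity in `f.sum` can be found in distinct members of `f`. -/
theorem exists_rel_mem_of_le_count {α : Type*} {D : ℕ} (V : Multiset α)
    (f : Multiset (Multiset α))
    (hf : ∀ U ∈ f, U.card ≤ D) (hV : ∀ h ∈ V, D * V.card ≤ f.sum.count h)
    (hD : 0 < D) :
    ∃ u ≤ f, Multiset.Rel (fun h U => h ∈ U) V u := by
  induction V using Multiset.induction generalizing f with
  | empty => exact ⟨0, Multiset.zero_le f, Multiset.Rel.zero⟩
  | cons h V ih =>
    have hpos : 0 < f.sum.count h := by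
      refine lt_of_lt_of_le ?_ (hV h (by simp))
      rw [Multiset.card_cons]
      positivity
    obtain ⟨U, hU, hhU⟩ := Multiset.mem_join.1 (Multiset.count_pos.1 hpos)
    obtain ⟨f, rfl⟩ := Multiset.exists_cons_of_mem hU
    obtain ⟨u, huf, hu⟩ := ih f (fun W hW => hf W (by simp [hW])) fun x hx => by
      have h1 := hV x (by simp [hx])
      have h2 := (Multiset.count_le_card x U).trans (hf U (by simp))
      rw [Multiset.card_cons, Multiset.sum_cons, Multiset.count_add, mul_add] at h1
      omega
    exact ⟨U ::ₘ u, Multiset.cons_le_cons U huf, Multiset.Rel.cons hhU hu⟩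

/-- Every extraction of an atom `V` over `G₀`, taking its terms from distinct atoms over `G₀`,
does not decrease the number of atoms. -/
def ExtractionMonotone (G₀ : Set G) : Prop :=
  ∀ (V : Multiset G) (u f : Multiset (Multiset G)), IsAtomSeqOn G₀ V →
    (∀ U ∈ u, IsAtomSeqOn G₀ U) → Multiset.Rel (fun h U => h ∈ U) V u →
    (∀ U ∈ f, IsAtomSeqOn G₀ U) → u.sum = V + f.sum → u.card ≤ f.card + 1

theorem ExtractionMonotone.extract {G₀ : Set G} (hP : ExtractionMonotone G₀) {D : ℕ} (hD : 0 < D)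
    (hDG : ∀ U : Multiset G, IsAtomSeqOn G₀ U → U.card ≤ D)
    {V R : Multiset G} {f : Multiset (Multiset G)}
    (hV : IsAtomSeqOn G₀ V) (hf : ∀ U ∈ f, IsAtomSeqOn G₀ U) (hs : f.sum = V + R)
    (hR : ∀ h ∈ V, D * D ≤ R.count h) :
    ∃ f' : Multiset (Multiset G), (∀ U ∈ f', IsAtomSeqOn G₀ U) ∧ f'.sum = R ∧
      f.card ≤ f'.card + 1 := by
  obtain ⟨u, huf, hu⟩ := exists_rel_mem_of_le_count V f (fun U hU => hDG U (hf U hU))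
    (fun h hh => by
      rw [hs, Multiset.count_add]
      exact (Nat.mul_le_mul_left D (hDG V hV)).trans ((hR h hh).trans (Nat.le_add_left _ _))) hD
  obtain ⟨r, rfl⟩ := Multiset.le_iff_exists_add.1 huf
  have hua : ∀ U ∈ u, IsAtomSeqOn G₀ U := fun U hU => hf U (by simp [hU])
  obtain ⟨C, hC, huC⟩ := exists_isProductOne_compl hV.2.2.1 (fun U hU => (hua U hU).2.2.1) hu
  have hC₀ : SeqOn G₀ C :=
    (seqOn_add.1 (huC ▸ seqOn_sum fun U hU => (hua U hU).1 : SeqOn G₀ (V + C))).2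
  obtain ⟨c, hc, rfl⟩ := exists_factorization C hC hC₀
  have := hP V u c hV hua hu hc huC
  refine ⟨c + r, fun U hU => ?_, ?_, ?_⟩
  · rcases Multiset.mem_add.1 hU with h | h
    exacts [hc U h, hf U (by simp [h])]
  · rw [Multiset.sum_add, huC, add_assoc] at hs
    rw [Multiset.sum_add, add_left_cancel hs]
  · rw [Multiset.card_add, Multiset.card_add]
    omega

theorem ExtractionMonotone.extract_all {G₀ : Set G} (hP : ExtractionMonotone G₀) {D : ℕ}
    (hD : 0 < D) (hDG : ∀ U : Multiset G, IsAtomSeqOn G₀ U → U.card ≤ D)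
    {R : Multiset G} (w f : Multiset (Multiset G)) (hw : ∀ U ∈ w, IsAtomSeqOn G₀ U)
    (hf : ∀ U ∈ f, IsAtomSeqOn G₀ U) (hs : f.sum = w.sum + R)
    (hR : ∀ h ∈ w.sum, D * D ≤ R.count h) :
    ∃ f' : Multiset (Multiset G), (∀ U ∈ f', IsAtomSeqOn G₀ U) ∧ f'.sum = R ∧
      f.card ≤ f'.card + w.card := by
  induction w using Multiset.induction generalizing f with
  | empty => exact ⟨f, hf, by simpa using hs, by simp⟩
  | cons V w ih =>
    rw [Multiset.sum_cons] at hs hR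
    rw [add_assoc] at hs
    obtain ⟨f₁, hf₁, hs₁, hc₁⟩ := hP.extract hD hDG (hw V (by simp)) hf hs fun h hh => by
      rw [Multiset.count_add]
      exact (hR h (by simp [hh])).trans (Nat.le_add_left _ _)
    obtain ⟨f₂, hf₂, hs₂, hc₂⟩ := ih f₁ (fun U hU => hw U (by simp [hU])) hf₁ hs₁
      fun h hh => hR h (by simp only [Multiset.mem_add]; exact Or.inr hh)
    exact ⟨f₂, hf₂, hs₂, by rw [Multiset.card_cons]; omega⟩

theorem mul_card_le_card_sum {α : Type*} {m : ℕ} (f : Multiset (Multiset α))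
    (hf : ∀ U ∈ f, m ≤ U.card) :
    m * f.card ≤ f.sum.card := by
  induction f using Multiset.induction with
  | empty => simp
  | cons U f ih =>
    have h1 := hf U (by simp)
    have h2 := ih fun W hW => hf W (by simp [hW])
    rw [Multiset.sum_cons, Multiset.card_cons, Multiset.card_add, mul_add]
    omega

theorem ExtractionMonotone.card_le_card [Finite G] {G₀ : Set G} (hP : ExtractionMonotone G₀)
    {z z' : Multiset (Multiset G)} (hz : ∀ U ∈ z, IsAtomSeqOn G₀ U)
    (hz' : ∀ U ∈ z', IsAtomSeqOn G₀ U) (hs : z.sum = z'.sum) : z'.card ≤ z.card := by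
  set K : ℕ := Nat.card G * Nat.card G
  set M : ℕ := K * z.sum.card + 1 with hM
  obtain ⟨f, hf, hfs, hfc⟩ := hP.extract_all (D := Nat.card G) (R := K • z.sum) Nat.card_pos
    (fun U hU => hU.2.card_le_natCard) (M • z) ((M + K) • z')
    (fun U hU => hz U (Multiset.mem_of_mem_nsmul hU))
    (fun U hU => hz' U (Multiset.mem_of_mem_nsmul hU))
    (by rw [Multiset.sum_nsmul, Multiset.sum_nsmul, add_nsmul, hs])
    (fun h hh => by
      rw [Multiset.sum_nsmul] at hh
      rw [Multiset.count_nsmul]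
      exact Nat.le_mul_of_pos_right _ (Multiset.count_pos.2 (Multiset.mem_of_mem_nsmul hh)))
  have h1 := mul_card_le_card_sum (m := 1) f fun U hU => Multiset.card_pos.2 (hf U hU).2.1
  rw [hfs, Multiset.card_nsmul] at h1
  rw [Multiset.card_nsmul, Multiset.card_nsmul] at hfc
  by_contra! hlt
  have h2 : M * (z.card + 1) ≤ (M + K) * z'.card :=
    Nat.mul_le_mul (Nat.le_add_right _ _) hlt
  rw [mul_add] at h2
  omega

theorem sInf_deltaOn_le {G₀ : Set G} {A : Multiset G} (hA₀ : SeqOn G₀ A) (hA : IsProductOne A)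
    {a b : ℕ} (ha : a ∈ lengthsOn G₀ A) (hb : b ∈ lengthsOn G₀ A) (hab : a < b) :
    sInf (DeltaOn G₀) ≤ b - a := by
  have hex : ∃ c, c ∈ lengthsOn G₀ A ∧ a < c := ⟨b, hb, hab⟩
  obtain ⟨hc, hac⟩ := Nat.find_spec hex
  have hle : Nat.find hex ≤ b := Nat.find_min' hex ⟨hb, hab⟩
  have hmem : Nat.find hex - a ∈ DeltaOn G₀ := by
    refine ⟨A, hA₀, hA, by omega, a, ha, ?_, ?_⟩
    · rwa [Nat.add_sub_cancel' hac.le]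
    · rintro c hcL ⟨h1, h2⟩
      exact Nat.find_min hex (by omega) ⟨hcL, h1⟩
  exact (Nat.sInf_le hmem).trans (by omega)

theorem sInf_deltaOn_le_of_factorizations {G₀ : Set G} {z z' : Multiset (Multiset G)}
    (hz : ∀ U ∈ z, IsAtomSeqOn G₀ U) (hz' : ∀ U ∈ z', IsAtomSeqOn G₀ U) (hs : z.sum = z'.sum)
    (hlt : z.card < z'.card) : sInf (DeltaOn G₀) ≤ z'.card - z.card :=
  sInf_deltaOn_le (A := z.sum) (seqOn_sum fun U hU => (hz U hU).1)
    (isProductOne_sum fun U hU => (hz U hU).2.2.1) ⟨z, rfl, hz, rfl⟩ ⟨z', rfl, hz', hs.symm⟩ hlt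

theorem not_extractionMonotone [Finite G] {G₀ : Set G} (h : (DeltaOn G₀).Nonempty) :
    ¬ExtractionMonotone G₀ := by
  intro hP
  obtain ⟨d, A, -, -, hd, a, ⟨z, rfl, hz, hzA⟩, ⟨z', hz'c, hz', hz'A⟩, -⟩ := h
  have := hP.card_le_card hz hz' (hzA.trans hz'A.symm)
  omega

theorem sInf_deltaOn_le_orderOf_sub_two [Finite G] {G₀ : Set G} {g : G} (hg : g ∈ G₀)
    (hg' : g⁻¹ ∈ G₀) (h3 : 3 ≤ orderOf g) : sInf (DeltaOn G₀) ≤ orderOf g - 2 := by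
  have hg1 : g ≠ 1 := by
    rintro rfl
    simp at h3
  have hrep : ∀ x ∈ G₀, IsAtomSeqOn G₀ (Multiset.replicate (orderOf x) x) := fun x hx =>
    ⟨fun y hy => Multiset.eq_of_mem_replicate hy ▸ hx, isAtomSeq_replicate_orderOf x⟩
  have hpair : IsAtomSeqOn G₀ ({g, g⁻¹} : Multiset G) := by
    refine ⟨fun y hy => ?_, isAtomSeq_pair_inv hg1⟩
    simp only [Multiset.insert_eq_cons, Multiset.mem_cons, Multiset.mem_singleton] at hy
    rcases hy with rfl | rfl
    exacts [hg, hg']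
  have := sInf_deltaOn_le_of_factorizations (G₀ := G₀)
    (z := {Multiset.replicate (orderOf g) g, Multiset.replicate (orderOf g⁻¹) g⁻¹})
    (z' := Multiset.replicate (orderOf g) {g, g⁻¹})
    (fun U hU => by
      simp only [Multiset.insert_eq_cons, Multiset.mem_cons, Multiset.mem_singleton] at hU
      rcases hU with rfl | rfl
      exacts [hrep g hg, hrep g⁻¹ hg'])
    (fun U hU => Multiset.eq_of_mem_replicate hU ▸ hpair)
    (by
      rw [Multiset.sum_replicate, Multiset.insert_eq_cons, Multiset.sum_cons,
        Multiset.sum_singleton, Multiset.insert_eq_cons, ← Multiset.singleton_add, nsmul_add,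
        Multiset.nsmul_singleton, Multiset.nsmul_singleton, orderOf_inv])
    (by simpa using Nat.lt_of_succ_le h3)
  simpa using this

/-- If the minimal distance over `G₀` is `D(G) - 2` and `G` is not cyclic, then some atom of
length `D(G)` consists of involutions. -/
theorem exists_atom_of_involutions [Finite G] (hcyc : ¬IsCyclic G) (hD : 3 ≤ Davenport G)
    {G₀ : Set G} (hne : (DeltaOn G₀).Nonempty) (hmin : sInf (DeltaOn G₀) = Davenport G - 2) :
    ∃ V : Multiset G, IsAtomSeq V ∧ V.card = Davenport G ∧ ∀ g ∈ V, orderOf g = 2 := by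
  have hP := not_extractionMonotone hne
  simp only [ExtractionMonotone, not_forall, not_le] at hP
  obtain ⟨V, u, f, hV, hu, hVu, hf, hs, hlt⟩ := hP
  have hcard := Multiset.card_eq_card_of_rel hVu
  have hVD := hV.2.card_le_davenport
  have hgap := sInf_deltaOn_le_of_factorizations (z := V ::ₘ f) (z' := u)
    (fun U hU => by
      rcases Multiset.mem_cons.1 hU with rfl | h
      exacts [hV, hf U h])
    hu (by rw [Multiset.sum_cons, hs]) (by rwa [Multiset.card_cons])
  rw [hmin, Multiset.card_cons] at hgap
  have hV1 : (1 : G) ∉ V := by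
    intro h1
    have := congrArg Multiset.card (hV.2.eq_singleton_one h1)
    rw [Multiset.card_singleton] at this
    omega
  have hu2 : ∀ U ∈ u, 2 ≤ U.card := by
    intro U hU
    by_contra! hlt2
    have := Multiset.card_pos.2 (hu U hU).2.1
    obtain ⟨x, rfl⟩ := Multiset.card_eq_one.1 (show U.card = 1 by omega)
    obtain ⟨h, hh, hhU⟩ :=
      Multiset.exists_mem_of_rel_of_mem (Multiset.rel_flip.2 hVu) hU
    have hx := isProductOne_singleton.1 (hu _ hU).2.2.1
    rw [flip, Multiset.mem_singleton, hx] at hhU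
    exact hV1 (hhU ▸ hh)
  have hsum := mul_card_le_card_sum u hu2
  have hsc := congrArg Multiset.card hs
  rw [Multiset.card_add] at hsc
  have hf1 : f.card = 1 := by
    by_contra hne1
    have : f = 0 := Multiset.card_eq_zero.1 (by omega)
    rw [this, Multiset.sum_zero, Multiset.card_zero] at hsc
    omega
  obtain ⟨W, rfl⟩ := Multiset.card_eq_one.1 hf1
  have hWD := (hf W (by simp)).2.card_le_davenport
  rw [Multiset.sum_singleton] at hsc
  refine ⟨V, hV.2, by omega, fun h hh => ?_⟩
  obtain ⟨U, hU, hhU⟩ := Multiset.exists_mem_of_rel_of_mem hVu hh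
  have hU2 : U.card = 2 := by
    obtain ⟨u', rfl⟩ := Multiset.exists_cons_of_mem hU
    have h1 := mul_card_le_card_sum u' fun X hX => hu2 X (by simp [hX])
    have h2 := hu2 U hU
    rw [Multiset.sum_cons, Multiset.card_add] at hsc
    rw [Multiset.card_cons] at *
    omega
  obtain ⟨t, rfl, ht⟩ := (hu U hU).2.2.1.exists_list_of_mem hhU
  have hinv : h⁻¹ ∈ G₀ := by
    rw [Multiset.card_cons, Multiset.coe_card] at hU2
    obtain ⟨k, rfl⟩ := List.length_eq_one_iff.1 (show t.length = 1 by omega)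
    rw [List.prod_singleton] at ht
    exact (hu _ hU).1 _ (by simp [ht])
  have hlt' := orderOf_lt_davenport hcyc h
  have hpos := orderOf_pos h
  have h1 : orderOf h ≠ 1 := fun h1 => hV1 (orderOf_eq_one_iff.1 h1 ▸ hh)
  by_contra h2
  have := sInf_deltaOn_le_orderOf_sub_two (hV.1 h hh) hinv (by omega)
  omega

theorem three_le_davenport [Finite G] (hcyc : ¬IsCyclic G) : 3 ≤ Davenport G := by
  have : Nontrivial G := not_subsingleton_iff_nontrivial.1 fun _ => hcyc inferInstance
  obtain ⟨g, hg⟩ := exists_ne (1 : G)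
  have h1 := orderOf_lt_davenport hcyc g
  have h2 : orderOf g ≠ 1 := fun h => hg (orderOf_eq_one_iff.1 h)
  have := orderOf_pos g
  omega

theorem davenportOn_le_davenport [Finite G] (G₀ : Set G) : DavenportOn G₀ ≤ Davenport G := by
  refine csSup_le' ?_
  rintro _ ⟨S, hS, rfl⟩
  exact hS.2.card_le_davenport

end ProductOne

open ProductOne in
/-- Let `G` be a finite group with `|G| ≥ 3`. If `max Δ*(G) = D(G) - 2`,
then `G` is cyclic or there is a subgroup `G₁ ≤ G` with `D(G₁) = D(G)` which is generated
by elements of order two. -/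
theorem max_deltaStar_eq_davenport_sub_two (G : Type*) [Group G] [Finite G]
    (hG : 3 ≤ Nat.card G) (h : sSup (DeltaStar G) = Davenport G - 2) :
    IsCyclic G ∨ ∃ G₁ : Subgroup G,
      DavenportOn (G₁ : Set G) = Davenport G ∧
      Subgroup.closure {g : G | g ∈ G₁ ∧ orderOf g = 2} = G₁ := by
  by_cases hcyc : IsCyclic G
  · exact Or.inl hcyc
  right
  have hD := three_le_davenport hcyc
  have hmem : sSup (DeltaStar G) ∈ DeltaStar G := by
    refine Nat.sSup_mem ?_ ?_
    · by_contra hemp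
      rw [Set.not_nonempty_iff_eq_empty.1 hemp, csSup_empty, Nat.bot_eq_zero] at h
      omega
    · by_contra hbdd
      rw [csSup_of_not_bddAbove hbdd, csSup_empty, Nat.bot_eq_zero] at h
      omega
  obtain ⟨G₀, hne, hmin⟩ := hmem
  obtain ⟨V, hV, hVc, hV2⟩ := exists_atom_of_involutions hcyc hD hne (hmin.symm.trans h)
  refine ⟨Subgroup.closure {g | g ∈ V}, le_antisymm (davenportOn_le_davenport _) ?_, ?_⟩
  · rw [← hVc]
    exact IsAtomSeqOn.card_le_davenportOn ⟨fun g hg => Subgroup.subset_closure hg, hV⟩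
  · refine le_antisymm ((Subgroup.closure_le _).2 fun g hg => hg.1) ?_
    exact Subgroup.closure_mono fun g hg => ⟨Subgroup.subset_closure hg, hV2 g hg⟩
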